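/- For (p, q) ∈ ℂ², let A(p,q) denote the 3-dimensional (non-unital) associative ℂ-algebra with basis e₁, e₂, e₃ whose only nonzero products of basis elements are e₁e₃ = p·e₂, e₃e₁ = q·e₂, and e₃e₃ = e₂. Then: (1) for every t ∈ ℂ with t ≠ 0, A(p,q) is isomorphic as a ℂ-algebra to A(t p, t q); and (2) A(p,q) is isomorphic as a ℂ-algebra to A(q,p). Hence the family A(p,q) is parameterized by the projective orbifold ℙ¹/Σ₂. -/

import Mathlib

/-- The multiplication of the 3-dimensional nilpotent algebra
`A(p,q) = d₂₀(p:q) = p ψ₂¹³ + q ψ₂³¹ + ψ₂³³`: on the basis `e₁, e₂, e₃` (coordinates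
`0, 1, 2`) the only nonzero products of basis elements are `e₁ e₃ = p e₂`, `e₃ e₁ = q e₂`
and `e₃ e₃ = e₂`. -/
noncomputable def mulA (p q : ℂ) (x y : Fin 3 → ℂ) : Fin 3 → ℂ :=
  fun i => if i = 1 then p * (x 0 * y 2) + q * (x 2 * y 0) + x 2 * y 2 else 0

/-- The linear automorphism `e₁ ↦ t⁻¹ e₁`, `e₂ ↦ e₂`, `e₃ ↦ e₃`. -/
noncomputable def scaleFirst (t : ℂ) (ht : t ≠ 0) : (Fin 3 → ℂ) ≃ₗ[ℂ] (Fin 3 → ℂ) where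
  toFun x := ![t⁻¹ * x 0, x 1, x 2]
  invFun x := ![t * x 0, x 1, x 2]
  map_add' x y := by ext i; fin_cases i <;> simp [mul_add]
  map_smul' c x := by ext i; fin_cases i <;> simp [mul_left_comm]
  left_inv x := by ext i; fin_cases i <;> simp [ht]
  right_inv x := by ext i; fin_cases i <;> simp [ht]

/-- The linear involution `e₁ ↦ -e₁ + s e₃`, `e₂ ↦ e₂`, `e₃ ↦ e₃`. -/
noncomputable def shearReflect (s : ℂ) : (Fin 3 → ℂ) ≃ₗ[ℂ] (Fin 3 → ℂ) where
  toFun x := ![-x 0, x 1, x 2 + s * x 0]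
  invFun x := ![-x 0, x 1, x 2 + s * x 0]
  map_add' x y := by ext i; fin_cases i <;> simp <;> ring
  map_smul' c x := by ext i; fin_cases i <;> simp; ring
  left_inv x := by ext i; fin_cases i <;> simp
  right_inv x := by ext i; fin_cases i <;> simp

/-- (1) for `t ≠ 0`, `A(p,q) ≅ A(tp, tq)` as ℂ-algebras, and
(2) `A(p,q) ≅ A(q,p)`; hence the family `A(p,q)` is parameterized by `ℙ¹/Σ₂`. -/
theorem mulA_projective_and_symmetric (p q : ℂ) :
    (∀ t : ℂ, t ≠ 0 → ∃ f : (Fin 3 → ℂ) ≃ₗ[ℂ] (Fin 3 → ℂ),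
        ∀ x y, f (mulA p q x y) = mulA (t * p) (t * q) (f x) (f y)) ∧
    (∃ g : (Fin 3 → ℂ) ≃ₗ[ℂ] (Fin 3 → ℂ),
        ∀ x y, g (mulA p q x y) = mulA q p (g x) (g y)) := by
  refine ⟨fun t ht => ⟨scaleFirst t ht, fun x y => ?_⟩, ⟨shearReflect (p + q), fun x y => ?_⟩⟩
  · ext i
    fin_cases i
    · simp [scaleFirst, mulA]
    · simp [scaleFirst, mulA]
      field_simp
    · simp [scaleFirst, mulA]
  · ext i
    fin_cases i
    · simp [shearReflect, mulA]
    · simp [shearReflect, mulA]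
      ring
    · simp [shearReflect, mulA]
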